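/- Let (Ω, F, μ) be a complete finite measure space, Y a separable Banach space, and X : Ω → 2^Y an integrably bounded set-valued map with nonempty, convex, weakly compact values and measurable graph. Then the set of integrable selections S¹_X = {x ∈ L¹(μ, Y) : x(ω) ∈ X(ω) μ-a.e.} is nonempty, convex, and weakly compact in L¹(μ, Y). -/

import Mathlib

open MeasureTheory

open Set Filter Topology

section MeasurableSelection

/-- Inner regularity of a finite measure on a continuous image of the Baire space. -/
theorem exists_isCompact_le_measure_image {Z : Type*} [TopologicalSpace Z]
    [TopologicalSpace.MetrizableSpace Z] [MeasurableSpace Z] [BorelSpace Z]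
    (ν : Measure Z) [IsFiniteMeasure ν] {p : (ℕ → ℕ) → Z} (hp : Continuous p)
    {c : ENNReal} (hc : c < ν (range p)) : ∃ K, IsCompact K ∧ c ≤ ν (p '' K) := by
  let := TopologicalSpace.metrizableSpaceMetric Z
  have step : ∀ (n : ℕ) (s : Set (ℕ → ℕ)), ∃ k : ℕ,
      c < ν (p '' s) → c < ν (p '' (s ∩ {x | x n ≤ k})) := by
    intro n s
    by_cases h : c < ν (p '' s)
    · have hmono : Monotone fun k : ℕ => p '' (s ∩ {x | x n ≤ k}) := fun i j hij =>
        image_mono (inter_subset_inter_right _ fun x (hx : x n ≤ i) => hx.trans hij)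
      have hU : p '' s = ⋃ k : ℕ, p '' (s ∩ {x | x n ≤ k}) := by
        rw [← image_iUnion, ← inter_iUnion, iUnion_eq_univ_iff.2 fun x => ⟨x n, le_refl (x n)⟩,
          inter_univ]
      rw [hU, hmono.measure_iUnion] at h
      obtain ⟨k, hk⟩ := lt_iSup_iff.1 h
      exact ⟨k, fun _ => hk⟩
    · exact ⟨0, fun h' => absurd h' h⟩
  choose k hk using step
  let S : ℕ → Set (ℕ → ℕ) := fun n =>
    Nat.rec univ (fun n s => s ∩ {x | x n ≤ k n s}) n
  have hS : ∀ n, S (n + 1) = S n ∩ {x | x n ≤ k n (S n)} := fun n => rfl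
  have hSc : ∀ n, c < ν (p '' S n) := by
    intro n
    induction n with
    | zero => simpa [S] using hc
    | succ n ih => rw [hS]; exact hk n _ ih
  have hSanti : Antitone S := antitone_nat_of_succ_le fun n => by
    rw [hS]; exact inter_subset_left
  set a : ℕ → ℕ := fun n => k n (S n) with ha
  have hSa : ∀ n, ∀ x ∈ S n, ∀ i < n, x i ≤ a i := by
    intro n x hx i hi
    have := hSanti (Nat.succ_le_of_lt hi) hx
    rw [Nat.succ_eq_add_one, hS] at this
    exact this.2
  have hK : IsCompact (Set.pi univ fun i => Iic (a i)) :=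
    isCompact_univ_pi fun i => (finite_Iic (a i)).isCompact
  refine ⟨_, hK, ?_⟩
  have hanti : Antitone fun n => closure (p '' S n) := fun i j hij =>
    closure_mono (image_mono (hSanti hij))
  have hle : c ≤ ν (⋂ n, closure (p '' S n)) := by
    rw [hanti.measure_iInter (fun n => isClosed_closure.nullMeasurableSet)
      ⟨0, measure_ne_top _ _⟩]
    exact le_iInf fun n => (hSc n).le.trans (measure_mono subset_closure)
  refine hle.trans (measure_mono fun z hz => ?_)
  have hx : ∀ n : ℕ, ∃ x ∈ S n, dist (p x) z < 1 / ((n : ℝ) + 1) := by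
    intro n
    obtain ⟨_, ⟨x, hx, rfl⟩, hd⟩ := Metric.mem_closure_iff.1 (mem_iInter.1 hz n) _
      (Nat.one_div_pos_of_nat (n := n) (α := ℝ))
    exact ⟨x, hx, by rwa [dist_comm]⟩
  choose x hxS hxd using hx
  obtain ⟨y, hy, φ, hφ, hlim⟩ := hK.tendsto_subseq (x := fun n i => min (x n i) (a i))
    fun n i _ => mem_Iic.2 (min_le_right _ _)
  have hlim' : Tendsto (fun n => x (φ n)) atTop (𝓝 y) := by
    rw [tendsto_pi_nhds] at hlim ⊢
    intro i
    refine (hlim i).congr' ?_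
    filter_upwards [eventually_gt_atTop i] with n hn
    exact min_eq_left (hSa _ _ (hxS _) i (hn.trans_le (hφ.id_le n)))
  refine ⟨y, hy, tendsto_nhds_unique ((hp.tendsto y).comp hlim') ?_⟩
  have hz : Tendsto (fun n => p (x n)) atTop (𝓝 z) :=
    tendsto_iff_dist_tendsto_zero.2 (squeeze_zero (fun _ => dist_nonneg)
      (fun n => (hxd n).le) tendsto_one_div_add_atTop_nhds_zero_nat)
  exact hz.comp hφ.tendsto_atTop

theorem exists_continuous_injective_real_of_nat_pi :
    ∃ r : (ℕ → ℕ) → ℝ, Continuous r ∧ Function.Injective r := by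
  let e : (ℕ → ℕ) → ℕ → Bool := fun x i => decide (x i.unpair.1 = i.unpair.2)
  have he : Continuous e := continuous_pi fun i =>
    (continuous_of_discreteTopology (f := fun m : ℕ => decide (m = i.unpair.2))).comp
      (continuous_apply i.unpair.1)
  have hinj : Function.Injective e := fun x y h => by
    ext n
    have := congrFun h (Nat.pair n (y n))
    simpa [e] using this
  refine ⟨fun x => Cardinal.cantorFunction (1 / 3) (e x), ?_,
    (Cardinal.cantorFunction_injective (by norm_num) (by norm_num)).comp hinj⟩
  refine continuous_tsum (u := fun n => (1 / 3 : ℝ) ^ n) (fun n => ?_)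
    (summable_geometric_of_lt_one (by norm_num) (by norm_num)) fun n x => ?_
  · exact (continuous_of_discreteTopology (f := fun b : Bool => bif b then (1 / 3 : ℝ) ^ n else 0)).comp
      ((continuous_apply n).comp he)
  · unfold Cardinal.cantorFunctionAux
    cases e x n <;> simp

/-- A continuous map on a compact subset of the Baire space has a Borel section. -/
theorem exists_measurable_section_of_isCompact {Z : Type*} [TopologicalSpace Z] [T2Space Z]
    [MeasurableSpace Z] [BorelSpace Z] {p : (ℕ → ℕ) → Z} (hp : Continuous p)
    {K : Set (ℕ → ℕ)} (hK : IsCompact K) :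
    ∃ s : Z → ℕ → ℕ, Measurable s ∧ ∀ z ∈ p '' K, p (s z) = z := by
  obtain ⟨r, hr, hri⟩ := exists_continuous_injective_real_of_nat_pi
  obtain ⟨r', hr', hrr⟩ := (hr.measurableEmbedding hri).exists_measurable_extend
    measurable_id fun _ => ⟨0⟩
  have hfib : ∀ z, IsCompact (K ∩ p ⁻¹' {z}) := fun z =>
    hK.inter_right (isClosed_singleton.preimage hp)
  have hmin : ∀ z ∈ p '' K, sInf (r '' (K ∩ p ⁻¹' {z})) ∈ r '' (K ∩ p ⁻¹' {z}) := by
    rintro z ⟨x, hx, hxz⟩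
    exact ((hfib z).image hr).sInf_mem (Nonempty.image r ⟨x, hx, hxz⟩)
  have hm : Measurable fun z => sInf (r '' (K ∩ p ⁻¹' {z})) := by
    refine measurable_of_Iic fun c => ?_
    have : (fun z => sInf (r '' (K ∩ p ⁻¹' {z}))) ⁻¹' Iic c =
        p '' (K ∩ r ⁻¹' Iic c) ∪ ((p '' K)ᶜ ∩ {_z | 0 ≤ c}) := by
      ext z
      by_cases hz : z ∈ p '' K
      · simp only [mem_preimage, mem_Iic, mem_union, mem_inter_iff, mem_compl_iff, hz,
          not_true_eq_false, false_and, or_false]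
        constructor
        · intro h
          obtain ⟨x, ⟨hx, hxz⟩, hxr⟩ := hmin z hz
          exact ⟨x, ⟨hx, by simpa [hxr] using h⟩, hxz⟩
        · rintro ⟨x, ⟨hx, hxc⟩, hxz⟩
          exact (csInf_le ((hfib z).image hr).bddBelow ⟨x, ⟨hx, hxz⟩, rfl⟩).trans hxc
      · have h1 : K ∩ p ⁻¹' {z} = ∅ := by
          ext x
          simp only [mem_inter_iff, mem_preimage, mem_singleton_iff, mem_empty_iff_false, iff_false]
          exact fun h => hz ⟨x, h⟩
        have h2 : z ∉ p '' (K ∩ r ⁻¹' Iic c) := fun h => hz (image_mono inter_subset_left h)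
        simp [h1, h2, hz, - mem_image]
    rw [this]
    exact ((hK.inter_right (isClosed_Iic.preimage hr)).image hp).measurableSet.union
      (((hK.image hp).measurableSet.compl).inter (MeasurableSet.const _))
  refine ⟨_, hr'.comp hm, fun z hz => ?_⟩
  obtain ⟨x, ⟨-, hxz⟩, hxr⟩ := hmin z hz
  have : r' (r x) = x := congrFun hrr x
  simp only [Function.comp_apply, ← hxr, this]
  exact hxz

/-- A measurable subset of a product is the preimage of a measurable set under a map that factors
the first coordinate through the Cantor space. -/
theorem exists_measurable_nat_bool_preimage {Ω Y : Type*} [MeasurableSpace Ω] [MeasurableSpace Y]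
    {G : Set (Ω × Y)} (hG : MeasurableSet G) :
    ∃ φ : Ω → ℕ → Bool, Measurable φ ∧ ∃ H : Set ((ℕ → Bool) × Y), MeasurableSet H ∧
      G = Prod.map φ id ⁻¹' H := by
  have hG' : MeasurableSet[MeasurableSpace.generateFrom
      (image2 (· ×ˢ ·) {s : Set Ω | MeasurableSet s} {t : Set Y | MeasurableSet t})] G := by
    rwa [generateFrom_prod]
  induction G, hG' using MeasurableSpace.generateFrom_induction with
  | hC G hG =>
    obtain ⟨s, hs, t, ht, rfl⟩ := ‹G ∈ image2 _ _ _›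
    classical
    refine ⟨fun ω _ => decide (ω ∈ s), measurable_pi_lambda _ fun _ =>
      measurable_to_bool (by simpa [preimage] using hs), {b | b 0 = true} ×ˢ t,
      MeasurableSet.prod ?_ ht, ?_⟩
    · exact (measurable_pi_apply (0 : ℕ) : Measurable fun b : ℕ → Bool => b 0)
        (measurableSet_singleton true)
    · ext ⟨ω, y⟩
      simp
  | empty => exact ⟨fun _ _ => true, measurable_const, ∅, .empty, by simp⟩
  | compl G h ih =>
    obtain ⟨φ, hφ, H, hH, rfl⟩ := ih (by rwa [generateFrom_prod] at h)
    exact ⟨φ, hφ, Hᶜ, hH.compl, rfl⟩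
  | iUnion G h ih =>
    choose φ hφ H hH hGH using fun n => ih n (by have := h n; rwa [generateFrom_prod] at this)
    let ψ : ℕ → (ℕ → Bool) → ℕ → Bool := fun n z m => z (Nat.pair n m)
    have hψ : ∀ n, Measurable (ψ n) := fun n =>
      measurable_pi_lambda _ fun m => measurable_pi_apply _
    refine ⟨fun ω k => φ k.unpair.1 ω k.unpair.2, measurable_pi_lambda _ fun k =>
      (measurable_pi_apply _).comp (hφ _), ⋃ n, Prod.map (ψ n) id ⁻¹' H n,
      .iUnion fun n => ((hψ n).prodMap measurable_id) (hH n), ?_⟩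
    ext ⟨ω, y⟩
    simp [hGH, ψ]

/-- **Aumann's measurable selection theorem**. -/
theorem exists_measurable_ae_selection {Ω Y : Type*} [MeasurableSpace Ω] [TopologicalSpace Y]
    [PolishSpace Y] [MeasurableSpace Y] [BorelSpace Y] [Nonempty Y] (μ : Measure Ω)
    [IsFiniteMeasure μ] {G : Set (Ω × Y)} (hG : MeasurableSet G)
    (hne : ∀ ω, ∃ y, (ω, y) ∈ G) :
    ∃ f : Ω → Y, Measurable f ∧ ∀ᵐ ω ∂μ, (ω, f ω) ∈ G := by
  obtain ⟨φ, hφ, H, hH, rfl⟩ := exists_measurable_nat_bool_preimage hG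
  rcases isEmpty_or_nonempty Ω with hΩ | ⟨⟨ω₀⟩⟩
  · exact ⟨fun _ => Classical.arbitrary Y, measurable_const, .of_forall fun ω => isEmptyElim ω⟩
  have : PolishSpace ((ℕ → Bool) × Y) := { }
  have hHa := hH.analyticSet
  rw [AnalyticSet] at hHa
  obtain rfl | ⟨f, hf, rfl⟩ := hHa
  · simpa using hne ω₀
  let p := fun x => (f x).1
  have hp : Continuous p := continuous_fst.comp hf
  have hrange : range φ ⊆ range p := by
    rintro _ ⟨ω, rfl⟩
    obtain ⟨y, x, hx⟩ := hne ω
    exact ⟨x, by simp [p, hx]⟩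
  have hν : μ.map φ (range p) = μ univ := by
    rw [← measure_toMeasurable, Measure.map_apply hφ (measurableSet_toMeasurable _ _)]
    congr 1
    exact eq_univ_of_forall fun ω => subset_toMeasurable _ _ (hrange ⟨ω, rfl⟩)
  have key : ∀ c < μ univ, ∃ (E : Set Ω) (g : Ω → Y), MeasurableSet E ∧ Measurable g ∧
      c ≤ μ E ∧ ∀ ω ∈ E, (φ ω, g ω) ∈ range f := by
    intro c hc
    obtain ⟨K, hK, hcK⟩ := exists_isCompact_le_measure_image (μ.map φ) hp (hν ▸ hc)
    obtain ⟨s, hs, hsK⟩ := exists_measurable_section_of_isCompact hp hK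
    have hpK := (hK.image hp).measurableSet
    refine ⟨φ ⁻¹' (p '' K), fun ω => (f (s (φ ω))).2, hφ hpK,
      (continuous_snd.comp hf).measurable.comp (hs.comp hφ),
      by rwa [Measure.map_apply hφ hpK] at hcK, fun ω hω => ⟨s (φ ω), ?_⟩⟩
    exact Prod.ext (hsK _ hω) rfl
  rcases eq_or_ne (μ univ) 0 with h0 | h0
  · exact ⟨fun _ => Classical.arbitrary Y, measurable_const, by
      rw [Measure.measure_univ_eq_zero.1 h0]; simp⟩
  obtain ⟨c, -, hc, hlim⟩ := exists_seq_strictMono_tendsto' (pos_iff_ne_zero.2 h0)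
  choose E g hE hg hcE hgE using fun n => key (c n) (hc n).2
  have hU : μ (⋃ n, E n)ᶜ = 0 := by
    rw [measure_compl (.iUnion hE) (measure_ne_top _ _), tsub_eq_zero_iff_le]
    exact le_of_tendsto' hlim fun n => (hcE n).trans (measure_mono (subset_iUnion _ _))
  classical
  have hfind : ∀ ω, ∃ n, ω ∈ E n ∨ ω ∉ ⋃ n, E n := fun ω => by
    by_cases h : ω ∈ ⋃ n, E n
    · exact (mem_iUnion.1 h).imp fun n => Or.inl
    · exact ⟨0, .inr h⟩
  refine ⟨fun ω => g (Nat.find (hfind ω)) ω,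
    Measurable.find (p := fun n ω => ω ∈ E n ∨ ω ∉ ⋃ n, E n) hg (fun n => (hE n).union (MeasurableSet.iUnion hE).compl) hfind, ?_⟩
  filter_upwards [compl_mem_ae_iff.2 hU] with ω hω
  rw [compl_compl] at hω
  exact hgE _ _ ((Nat.find_spec (hfind ω)).resolve_right fun h => h hω)

end MeasurableSelection

section DualOfL1

/-- A bounded additive function on a dense subgroup extends to a continuous linear functional. -/
theorem exists_strongDual_extending_of_dense {Y : Type*} [NormedAddCommGroup Y] [NormedSpace ℝ Y]
    {D : AddSubgroup Y} (hD : Dense (D : Set Y)) {f : Y → ℝ} {M : ℝ} (hM : 0 ≤ M)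
    (hadd : ∀ y ∈ D, ∀ z ∈ D, f (y + z) = f y + f z) (hbd : ∀ y ∈ D, |f y| ≤ M * ‖y‖) :
    ∃ l : StrongDual ℝ Y, (∀ y, |l y| ≤ M * ‖y‖) ∧ ∀ y ∈ D, l y = f y := by
  have hlip : LipschitzOnWith M.toNNReal f D := by
    refine LipschitzOnWith.of_dist_le_mul fun y hy z hz => ?_
    have h := hadd _ (D.sub_mem hy hz) _ hz
    rw [sub_add_cancel] at h
    rw [Real.dist_eq, dist_eq_norm, Real.coe_toNNReal _ hM, h, add_sub_cancel_right]
    exact hbd _ (D.sub_mem hy hz)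
  obtain ⟨g, hg, hfg⟩ := hlip.extend_real
  have hgc := hg.continuous
  have hadd' : ∀ y z, g (y + z) = g y + g z := by
    have hcl : IsClosed {q : Y × Y | g (q.1 + q.2) = g q.1 + g q.2} :=
      isClosed_eq (by fun_prop) (by fun_prop)
    have huniv := (hD.prod hD).closure_eq ▸ closure_minimal (fun q (hq : q ∈ (D : Set Y) ×ˢ D) => by
      rw [mem_ofPred_eq, ← hfg hq.1, ← hfg hq.2, ← hfg (D.add_mem hq.1 hq.2)]
      exact hadd _ hq.1 _ hq.2) hcl
    exact fun y z => huniv (mem_univ (y, z))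
  have hbd' : ∀ y, |g y| ≤ M * ‖y‖ := by
    have hcl : IsClosed {y | |g y| ≤ M * ‖y‖} := isClosed_le (by fun_prop) (by fun_prop)
    have huniv := hD.closure_eq ▸ closure_minimal (fun y (hy : y ∈ (D : Set Y)) => by
      rw [mem_ofPred_eq, ← hfg hy]
      exact hbd y hy) hcl
    exact fun y => huniv (mem_univ y)
  exact ⟨(AddMonoidHom.mk' g hadd').toRealLinearMap hgc, hbd', fun y hy => (hfg hy).symm⟩

variable {Ω Y : Type*} [MeasurableSpace Ω] [NormedAddCommGroup Y] [NormedSpace ℝ Y]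
  {μ : Measure Ω} [IsFiniteMeasure μ]

theorem holderL_indicatorConstLp_const {s : Set Ω} (hs : MeasurableSet s) (c : Y) :
    (ContinuousLinearMap.lsmul ℝ ℝ).holderL μ 2 2 1 (indicatorConstLp 2 hs (measure_ne_top μ s) 1)
      (Lp.constL 2 μ ℝ c) = indicatorConstLp 1 hs (measure_ne_top μ s) c := by
  refine Lp.ext ?_
  filter_upwards [(ContinuousLinearMap.lsmul ℝ ℝ).coeFn_holder (r := 1)
      (indicatorConstLp 2 hs (measure_ne_top μ s) (1 : ℝ)) (Lp.constL 2 μ ℝ c),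
    indicatorConstLp_coeFn (p := 2) (hs := hs) (hμs := measure_ne_top μ s) (c := (1 : ℝ)),
    indicatorConstLp_coeFn (p := 1) (hs := hs) (hμs := measure_ne_top μ s) (c := c),
    Lp.coeFn_const (p := 2) (μ := μ) c] with ω h1 h2 h3 h4
  rw [h3]
  refine h1.trans ?_
  rw [h2, Lp.constL_apply, h4]
  by_cases hω : ω ∈ s <;> simp [hω]

/-- The densities of the scalar measures `E ↦ Λ (1_E y)`. -/
theorem exists_L2_density (Λ : StrongDual ℝ (Lp Y 1 μ)) :
    ∃ L : Y →+ Lp ℝ 2 μ, (∀ y s (hs : MeasurableSet s),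
        ∫ ω in s, L y ω ∂μ = Λ (indicatorConstLp 1 hs (measure_ne_top μ s) y)) ∧
      ∀ y, ∀ᵐ ω ∂μ, |L y ω| ≤ ‖Λ‖ * ‖y‖ := by
  let A := (ContinuousLinearMap.lsmul ℝ ℝ (E := Y)).holderL μ 2 2 1
  let L : Y →+ Lp ℝ 2 μ := AddMonoidHom.mk'
    (fun y => (InnerProductSpace.toDual ℝ (Lp ℝ 2 μ)).symm (Λ ∘L A.flip (Lp.constL 2 μ ℝ y)))
    fun y z => by simp only [map_add, ContinuousLinearMap.comp_add]
  have hL : ∀ y s (hs : MeasurableSet s),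
      ∫ ω in s, L y ω ∂μ = Λ (indicatorConstLp 1 hs (measure_ne_top μ s) y) := by
    intro y s hs
    rw [← L2.inner_indicatorConstLp_one hs (measure_ne_top μ s), real_inner_comm,
      ← holderL_indicatorConstLp_const]
    exact InnerProductSpace.toDual_symm_apply
  have hint : ∀ y, Integrable (L y) μ := fun y =>
    (Lp.memLp (L y)).integrable one_le_two
  have habs : ∀ y s (hs : MeasurableSet s),
      |∫ ω in s, L y ω ∂μ| ≤ ∫ _ω in s, ‖Λ‖ * ‖y‖ ∂μ := by
    intro y s hs
    rw [hL y s hs, setIntegral_const, ← Real.norm_eq_abs]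
    refine (Λ.le_opNorm _).trans_eq ?_
    rw [norm_indicatorConstLp one_ne_zero ENNReal.one_ne_top]
    simp
    ring
  refine ⟨L, hL, fun y => ?_⟩
  have h1 := ae_le_of_forall_setIntegral_le (hint y) (integrable_const (‖Λ‖ * ‖y‖))
    fun s hs _ => (le_abs_self _).trans (habs y s hs)
  have h2 := ae_le_of_forall_setIntegral_le (hint y).neg (integrable_const (‖Λ‖ * ‖y‖))
    fun s hs _ => by
      simp only [Pi.neg_apply, integral_neg]
      exact (neg_le_abs _).trans (habs y s hs)
  filter_upwards [h1, h2] with ω h1 h2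
  exact abs_le'.2 ⟨h1, h2⟩

/-- A continuous functional on `L¹(μ, Y)` is given by a bounded weak-* measurable function into the
dual of `Y` when `Y` is separable. -/
theorem exists_weakStar_density [SecondCountableTopology Y]
    (Λ : StrongDual ℝ (Lp Y 1 μ)) :
    ∃ l : Ω → StrongDual ℝ Y, (∀ ω y, |l ω y| ≤ ‖Λ‖ * ‖y‖) ∧
      (∀ x : Ω → Y, AEStronglyMeasurable x μ → AEStronglyMeasurable (fun ω => l ω (x ω)) μ) ∧
      ∀ x : Lp Y 1 μ, Λ x = ∫ ω, l ω (x ω) ∂μ := by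
  obtain ⟨L, hL, hLb⟩ := exists_L2_density Λ
  let T := Finsupp.linearCombination ℤ (TopologicalSpace.denseSeq Y)
  let D : AddSubgroup Y := T.range.toAddSubgroup
  have : Countable D := (countable_range T).to_subtype
  have hD : Dense (D : Set Y) := (TopologicalSpace.denseRange_denseSeq Y).mono <| by
    rintro _ ⟨n, rfl⟩
    exact ⟨Finsupp.single n 1, by simp [T]⟩
  have hgood : ∀ᵐ ω ∂μ, (∀ y z : D, L (y + z : Y) ω = L y ω + L z ω) ∧
      ∀ y : D, |L y ω| ≤ ‖Λ‖ * ‖(y : Y)‖ := by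
    refine (ae_all_iff.2 fun y => ae_all_iff.2 fun z => ?_).and (ae_all_iff.2 fun y => hLb y)
    rw [map_add]
    exact Lp.coeFn_add _ _
  obtain ⟨t, ht, htm, htμ⟩ := exists_measurable_superset_of_null (ae_iff.1 hgood)
  have hext : ∀ ω, ∃ l : StrongDual ℝ Y, (∀ y, |l y| ≤ ‖Λ‖ * ‖y‖) ∧
      ∀ y ∈ D, l y = tᶜ.indicator (L y) ω := by
    intro ω
    refine exists_strongDual_extending_of_dense hD (norm_nonneg Λ) (fun y hy z hz => ?_)
      fun y hy => ?_
    all_goals by_cases hω : ω ∈ t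
    · simp [hω]
    · simpa [hω] using (not_not.1 fun h => hω (ht h)).1 ⟨y, hy⟩ ⟨z, hz⟩
    · simp only [mem_compl_iff, hω, not_true_eq_false, not_false_eq_true, indicator_of_notMem,
        abs_zero]
      positivity
    · simpa [hω] using (not_not.1 fun h => hω (ht h)).2 ⟨y, hy⟩
  choose l hlb hlD using hext
  have hlm : ∀ y, Measurable fun ω => l ω y := by
    intro y
    obtain ⟨d, hdD, hd⟩ := mem_closure_iff_seq_limit.1 (hD y)
    refine measurable_of_tendsto_metrizable (f := fun n ω => l ω (d n)) (fun n => ?_)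
      (tendsto_pi_nhds.2 fun ω => ((l ω).continuous.tendsto y).comp hd)
    simp only [hlD _ _ (hdD n)]
    exact (Lp.stronglyMeasurable _).measurable.indicator htm.compl
  have hlx : ∀ x : Ω → Y, AEStronglyMeasurable x μ →
      AEStronglyMeasurable (fun ω => l ω (x ω)) μ := by
    intro x hx
    borelize Y
    have := stronglyMeasurable_uncurry_of_continuous_of_stronglyMeasurable
      (u := fun y ω => l ω y) (fun ω => (l ω).continuous) fun y => (hlm y).stronglyMeasurable
    exact (this.aestronglyMeasurable (μ := μ.map fun ω => (x ω, ω))).comp_aemeasurable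
      (hx.aemeasurable.prodMk aemeasurable_id)
  refine ⟨l, hlb, hlx, ?_⟩
  have hint : ∀ x : Lp Y 1 μ, Integrable (fun ω => l ω (x ω)) μ := fun x =>
    (((memLp_one_iff_integrable.1 (Lp.memLp x)).norm.const_mul ‖Λ‖)).mono'
      (hlx x (Lp.aestronglyMeasurable x)) (.of_forall fun ω => hlb ω _)
  let I : StrongDual ℝ (Lp Y 1 μ) := LinearMap.mkContinuous
    { toFun := fun x => ∫ ω, l ω (x ω) ∂μ
      map_add' := fun x y => by
        rw [← integral_add (hint x) (hint y)]
        refine integral_congr_ae ?_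
        filter_upwards [Lp.coeFn_add x y] with ω hω
        exact (congrArg (l ω) hω).trans (map_add _ _ _)
      map_smul' := fun a x => by
        rw [RingHom.id_apply, smul_eq_mul, ← integral_const_mul]
        refine integral_congr_ae ?_
        filter_upwards [Lp.coeFn_smul a x] with ω hω
        exact (congrArg (l ω) hω).trans (map_smul _ _ _) } ‖Λ‖ fun x => by
      rw [L1.norm_eq_integral_norm, ← integral_const_mul]
      exact (norm_integral_le_integral_norm _).trans (integral_mono (hint x).norm
        ((memLp_one_iff_integrable.1 (Lp.memLp x)).norm.const_mul ‖Λ‖) fun ω => hlb ω _)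
  have hind : ∀ (s : Set Ω) (hs : MeasurableSet s) (c : Y),
      Λ (indicatorConstLp 1 hs (measure_ne_top μ s) c) =
        I (indicatorConstLp 1 hs (measure_ne_top μ s) c) := by
    intro s hs
    simp only [← holderL_indicatorConstLp_const]
    refine congrFun (Continuous.ext_on hD (by fun_prop) (by fun_prop) fun y hy => ?_)
    simp only [holderL_indicatorConstLp_const]
    rw [← hL, ← integral_indicator hs]
    refine integral_congr_ae ?_
    filter_upwards [indicatorConstLp_coeFn (p := 1) (hs := hs) (hμs := measure_ne_top μ s) (c := y),
      compl_mem_ae_iff.2 htμ] with ω hω hωt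
    rw [hω]
    by_cases hωs : ω ∈ s
    · simp [hωs, hlD ω y hy, indicator_of_mem hωt]
    · simp [hωs]
  intro x
  change Λ x = I x
  induction x using Lp.induction ENNReal.one_ne_top with
  | indicatorConst c hs hμs => exact hind _ hs c
  | add hf hg _ h1 h2 => rw [map_add, map_add, h1, h2]
  | isClosed => exact isClosed_eq Λ.continuous I.continuous

end DualOfL1

section WeakCompactness

theorem tendsto_toWeakSpace_iff {ι E : Type*} [AddCommGroup E] [Module ℝ E] [TopologicalSpace E]
    {l : Filter ι} {f : ι → E} {x : E} :
    Tendsto (fun i => toWeakSpace ℝ E (f i)) l (𝓝 (toWeakSpace ℝ E x)) ↔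
      ∀ L : StrongDual ℝ E, Tendsto (fun i => L (f i)) l (𝓝 (L x)) := by
  constructor
  · intro h L
    exact ((WeakBilin.eval_continuous (topDualPairing ℝ E).flip L).tendsto _).comp h
  · intro h
    have hind : IsInducing fun (y : WeakSpace ℝ E) (L : StrongDual ℝ E) =>
      (topDualPairing ℝ E).flip y L := ⟨rfl⟩
    exact hind.tendsto_nhds_iff.2 (tendsto_pi_nhds.2 h)

/-- Along an ultrafilter, bounded maps into a Hilbert space converge weakly. -/
theorem Ultrafilter.exists_tendsto_inner {E H : Type*} [NormedAddCommGroup H]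
    [InnerProductSpace ℝ H] [CompleteSpace H] (U : Ultrafilter E) {T : E → H} {R : ℝ}
    (hR : ∀ᶠ x in U, ‖T x‖ ≤ R) :
    ∃ v : H, ∀ L : StrongDual ℝ H, Tendsto (fun x => L (T x)) U (𝓝 (L v)) := by
  let D : E → WeakDual ℝ H := fun x => (InnerProductSpace.toDual ℝ H (T x) : StrongDual ℝ H)
  obtain ⟨ψ, -, hψ⟩ := isCompact_iff_ultrafilter_le_nhds.1
    (WeakDual.isCompact_closedBall (𝕜 := ℝ) (0 : StrongDual ℝ H) R) (U.map D) <| by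
      rw [le_principal_iff, Ultrafilter.mem_coe, Ultrafilter.mem_map]
      filter_upwards [hR] with x hx
      change InnerProductSpace.toDual ℝ H (T x) ∈ Metric.closedBall (0 : StrongDual ℝ H) R
      simpa using hx
  refine ⟨(InnerProductSpace.toDual ℝ H).symm ψ, fun L => ?_⟩
  have h := tendsto_iff_forall_eval_tendsto_topDualPairing.1 (show Tendsto D U (𝓝 ψ) from hψ)
    ((InnerProductSpace.toDual ℝ H).symm L)
  have h1 : ∀ x, L (T x) = inner ℝ ((InnerProductSpace.toDual ℝ H).symm L) (T x) := fun x =>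
    (InnerProductSpace.toDual_symm_apply (𝕜 := ℝ)).symm
  have h2 : L ((InnerProductSpace.toDual ℝ H).symm ψ) =
      (ψ : StrongDual ℝ H) ((InnerProductSpace.toDual ℝ H).symm L) := by
    rw [← InnerProductSpace.toDual_symm_apply (𝕜 := ℝ) (y := L), real_inner_comm]
    exact InnerProductSpace.toDual_symm_apply
  rw [h2]
  refine h.congr fun x => ?_
  rw [h1, real_inner_comm]
  rfl

/-- A convex set is weakly compact as soon as an affine injection into a Hilbert space with bounded
image maps each of its intersections with a closed half-space to a closed set. -/
theorem isCompact_toWeakSpace_image_of_affine_injOn {E H : Type*} [NormedAddCommGroup E]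
    [NormedSpace ℝ E] [NormedAddCommGroup H] [InnerProductSpace ℝ H] [CompleteSpace H] {S : Set E}
    (hS : Convex ℝ S) {T : E → H}
    (hT : ∀ x ∈ S, ∀ y ∈ S, ∀ a b : ℝ, 0 ≤ a → 0 ≤ b → a + b = 1 →
      T (a • x + b • y) = a • T x + b • T y)
    (hinj : InjOn T S) {R : ℝ} (hR : ∀ x ∈ S, ‖T x‖ ≤ R)
    (hcl : ∀ (L : StrongDual ℝ E) (c : ℝ), IsClosed (T '' (S ∩ {x | L x ≤ c}))) :
    IsCompact (toWeakSpace ℝ E '' S) := by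
  refine isCompact_iff_ultrafilter_le_nhds.2 fun U hU => ?_
  let V : Ultrafilter E := U.map (toWeakSpace ℝ E).symm
  have hVS : S ∈ V := by
    rw [Ultrafilter.mem_map]
    filter_upwards [le_principal_iff.1 hU]
    rintro _ ⟨x, hx, rfl⟩
    simpa using hx
  obtain ⟨v, hv⟩ := V.exists_tendsto_inner (T := T) (R := R) (mem_of_superset hVS hR)
  have hmem : ∀ (L : StrongDual ℝ E) (c : ℝ), {x | L x ≤ c} ∈ V →
      v ∈ T '' (S ∩ {x | L x ≤ c}) := by
    intro L c hc
    by_contra hvc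
    have hconv : Convex ℝ (T '' (S ∩ {x | L x ≤ c})) := by
      rintro _ ⟨x, hx, rfl⟩ _ ⟨y, hy, rfl⟩ a b ha hb hab
      exact ⟨a • x + b • y, (hS.inter (convex_halfSpace_le L.isLinear c)) hx hy ha hb hab,
        hT x hx.1 y hy.1 a b ha hb hab⟩
    obtain ⟨f, u, hfu, huv⟩ := geometric_hahn_banach_closed_point hconv (hcl L c) hvc
    refine huv.not_ge (le_of_tendsto (hv f) ?_)
    filter_upwards [hVS, hc] with x hxS hxc
    exact (hfu _ ⟨x, ⟨hxS, hxc⟩, rfl⟩).le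
  obtain ⟨x, ⟨hxS, -⟩, rfl⟩ := hmem 0 0 (mem_of_superset hVS fun x _ => by simp)
  refine ⟨_, ⟨x, hxS, rfl⟩, ?_⟩
  have hle : ∀ (L : StrongDual ℝ E) (c : ℝ), {x | L x ≤ c} ∈ V → L x ≤ c := by
    intro L c hc
    obtain ⟨y, ⟨hyS, hyc⟩, hyx⟩ := hmem L c hc
    rwa [← hinj hyS hxS hyx]
  have hlt : ∀ (L : StrongDual ℝ E) (c : ℝ), c < L x → ∀ᶠ y in V, c < L y := by
    intro L c hc
    by_contra h
    refine hc.not_ge (hle L c ?_)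
    have h' := Ultrafilter.eventually_not.2 h
    simp only [not_lt] at h'
    exact h'
  have hlim : Tendsto (fun y => toWeakSpace ℝ E y) V (𝓝 (toWeakSpace ℝ E x)) := by
    refine tendsto_toWeakSpace_iff.2 fun L => tendsto_order.2 ⟨hlt L, fun c hc => ?_⟩
    filter_upwards [hlt (-L) (-c) (by simpa using hc)] with y hy
    simpa using hy
  simpa [V, Tendsto, Filter.map_map, Function.comp_def] using hlim

end WeakCompactness

section Selections

theorem exists_separating_seq (Y : Type*) [NormedAddCommGroup Y] [NormedSpace ℝ Y]
    [SecondCountableTopology Y] :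
    ∃ φ : ℕ → StrongDual ℝ Y, (∀ j, ‖φ j‖ ≤ 1) ∧ ∀ y z, (∀ j, φ j y = φ j z) → y = z := by
  choose φ hφ hφd using fun j => exists_dual_vector'' ℝ (TopologicalSpace.denseSeq Y j)
  refine ⟨φ, hφ, fun y z hyz => ?_⟩
  rw [← sub_eq_zero, ← norm_le_zero_iff]
  refine le_of_forall_pos_le_add fun ε hε => ?_
  obtain ⟨j, hj⟩ := (TopologicalSpace.denseRange_denseSeq Y).exists_dist_lt (y - z) (half_pos hε)
  rw [dist_eq_norm] at hj
  have h1 : φ j (y - z - TopologicalSpace.denseSeq Y j) = -‖TopologicalSpace.denseSeq Y j‖ := by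
    rw [map_sub, map_sub, hyz j, hφd j]
    simp
  have h2 := (φ j).le_of_opNorm_le (hφ j) (y - z - TopologicalSpace.denseSeq Y j)
  rw [h1, norm_neg, norm_norm, one_mul] at h2
  have h3 := norm_add_le (y - z - TopologicalSpace.denseSeq Y j) (TopologicalSpace.denseSeq Y j)
  rw [sub_add_cancel] at h3
  linarith

/-- On a weakly compact set, convergence against a separating family of functionals is weak
convergence. -/
theorem IsCompact.exists_weak_limit_of_separating {Y ι κ : Type*} [NormedAddCommGroup Y]
    [NormedSpace ℝ Y] {K : Set Y} (hK : IsCompact (toWeakSpace ℝ Y '' K))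
    {φ : κ → StrongDual ℝ Y} (hφ : ∀ y z, (∀ j, φ j y = φ j z) → y = z)
    {l : Filter ι} [l.NeBot] {x : ι → Y} (hx : ∀ i, x i ∈ K) {v : κ → ℝ}
    (hv : ∀ j, Tendsto (fun i => φ j (x i)) l (𝓝 (v j))) :
    ∃ y ∈ K, (∀ j, φ j y = v j) ∧ ∀ L : StrongDual ℝ Y, Tendsto (fun i => L (x i)) l (𝓝 (L y)) := by
  have hxK : ∀ i, toWeakSpace ℝ Y (x i) ∈ toWeakSpace ℝ Y '' K := fun i => ⟨_, hx i, rfl⟩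
  have hclu : ∀ z, MapClusterPt (toWeakSpace ℝ Y z) l (fun i => toWeakSpace ℝ Y (x i)) →
      ∀ j, φ j z = v j := by
    intro z hz j
    obtain ⟨U, hU, hUz⟩ := mapClusterPt_iff_ultrafilter.1 hz
    exact tendsto_nhds_unique (tendsto_toWeakSpace_iff.1 hUz (φ j)) ((hv j).mono_left hU)
  obtain ⟨_, ⟨y, hyK, rfl⟩, hy⟩ := hK.exists_mapClusterPt_of_frequently
    (Eventually.of_forall (f := l) hxK).frequently
  refine ⟨y, hyK, hclu y hy, tendsto_toWeakSpace_iff.1 ?_⟩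
  refine hK.tendsto_nhds_of_unique_mapClusterPt (.of_forall hxK) ?_
  rintro _ ⟨z, hzK, rfl⟩ hz
  rw [hφ z y fun j => by rw [hclu z hz, hclu y hy]]

variable {Ω Y : Type*} [MeasurableSpace Ω] [NormedAddCommGroup Y] [NormedSpace ℝ Y]
  [CompleteSpace Y] [SecondCountableTopology Y] {μ : Measure Ω} [IsFiniteMeasure μ]

theorem isCompact_toWeakSpace_image_selections {X : Ω → Set Y}
    (hwcomp : ∀ ω, IsCompact (toWeakSpace ℝ Y '' X ω)) {k : Ω → ℝ} (hkm : StronglyMeasurable k)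
    (hk : Integrable k μ) (hk0 : ∀ ω, 0 ≤ k ω) (hXk : ∀ᵐ ω ∂μ, ∀ y ∈ X ω, ‖y‖ ≤ k ω)
    (hS : Convex ℝ {x : Lp Y 1 μ | ∀ᵐ ω ∂μ, x ω ∈ X ω}) :
    IsCompact (toWeakSpace ℝ (Lp Y 1 μ) '' {x : Lp Y 1 μ | ∀ᵐ ω ∂μ, x ω ∈ X ω}) := by
  borelize Y
  obtain ⟨φ, hφ1, hφ⟩ := exists_separating_seq Y
  let w : Ω → ℝ := fun ω => (1 + k ω)⁻¹
  have hw0 : ∀ ω, 0 < w ω := fun ω => inv_pos.2 (by linarith [hk0 ω])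
  have hwk : ∀ ω, w ω * k ω ≤ 1 := fun ω => by
    rw [inv_mul_le_one₀ (by linarith [hk0 ω])]
    linarith
  have hwm : Measurable w := (measurable_const.add hkm.measurable).inv
  let ν : Measure ℕ := Measure.count.toFinite
  have hν : ∀ {P : ℕ → Prop}, (∀ᵐ j ∂ν, P j) → ∀ j, P j := fun {P} h j => by
    have h' : ∀ᵐ j ∂(Measure.count : Measure ℕ), P j := by rwa [← ae_toFinite]
    by_contra hj
    have := measure_mono_null (singleton_subset_iff.2 hj) (ae_iff.1 h')
    simp at this
  have hprod : ∀ {P : Ω × ℕ → Prop}, (∀ᵐ q ∂μ.prod ν, P q) → ∀ᵐ ω ∂μ, ∀ j, P (ω, j) := fun h => by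
    filter_upwards [Measure.ae_ae_of_ae_prod h] with ω hω using hν hω
  have hfst : ∀ {P : Ω → Prop}, (∀ᵐ ω ∂μ, P ω) → ∀ᵐ q ∂μ.prod ν, P q.1 := fun h =>
    Measure.quasiMeasurePreserving_fst.ae h
  set S : Set (Lp Y 1 μ) := {x : Lp Y 1 μ | ∀ᵐ ω ∂μ, x ω ∈ X ω} with hSdef
  let F : Lp Y 1 μ → Ω × ℕ → ℝ := fun x q => w q.1 * φ q.2 (x q.1)
  have hFm : ∀ x, Measurable (F x) := fun x => measurable_from_prod_countable_left fun j =>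
    hwm.mul ((φ j).continuous.measurable.comp (Lp.stronglyMeasurable x).measurable)
  have hFb : ∀ x ∈ S, ∀ᵐ q ∂μ.prod ν, ‖F x q‖ ≤ 1 := by
    intro x hx
    filter_upwards [hfst hx, hfst hXk] with q h1 h2
    rw [norm_mul, Real.norm_of_nonneg (hw0 _).le]
    refine le_trans ?_ (hwk q.1)
    gcongr
    · exact (hw0 _).le
    · simpa using ((φ q.2).le_of_opNorm_le (hφ1 _) _).trans
        (mul_le_mul_of_nonneg_left (h2 _ h1) zero_le_one)
  have hFL : ∀ x ∈ S, MemLp (F x) 2 (μ.prod ν) := fun x hx =>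
    .of_bound (hFm x).aestronglyMeasurable 1 (hFb x hx)
  classical
  let T : Lp Y 1 μ → Lp ℝ 2 (μ.prod ν) := fun x =>
    if hx : MemLp (F x) 2 (μ.prod ν) then hx.toLp else 0
  have hTF : ∀ x ∈ S, T x =ᵐ[μ.prod ν] F x := by
    intro x hx
    simp only [T, dif_pos (hFL x hx)]
    exact MemLp.coeFn_toLp _
  refine isCompact_toWeakSpace_image_of_affine_injOn hS (T := T) ?_ ?_
    (R := (μ.prod ν).real univ ^ (2 : ENNReal).toReal⁻¹ * 1) ?_ ?_
  · intro x hx y hy a b ha hb hab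
    refine Lp.ext ?_
    filter_upwards [hTF _ (hS hx hy ha hb hab), hTF x hx, hTF y hy,
      Lp.coeFn_add (a • T x) (b • T y), Lp.coeFn_smul a (T x), Lp.coeFn_smul b (T y),
      hfst (Lp.coeFn_add (a • x) (b • y)), hfst (Lp.coeFn_smul a x), hfst (Lp.coeFn_smul b y)]
      with q h1 h2 h3 h4 h5 h6 h7 h8 h9
    rw [h1, h4, Pi.add_apply, h5, h6, Pi.smul_apply, Pi.smul_apply, h2, h3]
    simp only [F, h7, Pi.add_apply, h8, h9, Pi.smul_apply, map_add, map_smul, smul_eq_mul]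
    ring
  · intro x hx y hy hxy
    have hF : F x =ᵐ[μ.prod ν] F y := (hTF x hx).symm.trans (hxy ▸ hTF y hy)
    refine Lp.ext ?_
    filter_upwards [hprod hF] with ω hω
    exact hφ _ _ fun j => mul_left_cancel₀ (hw0 ω).ne' (hω j)
  · intro x hx
    refine Lp.norm_le_of_ae_bound zero_le_one ?_
    filter_upwards [hTF x hx, hFb x hx] with q h1 h2
    rwa [h1]
  intro L c
  refine IsSeqClosed.isClosed fun u' u hu' hlim => ?_
  choose x hx hxu using hu'
  obtain rfl : (fun n => T (x n)) = u' := funext hxu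
  obtain ⟨ns, hns, hae⟩ := (tendstoInMeasure_of_tendsto_Lp hlim).exists_seq_tendsto_ae
  obtain ⟨l, hlb, hlm, hL⟩ := exists_weakStar_density L
  have hxX : ∀ᵐ ω ∂μ, ∀ n, x n ω ∈ X ω := ae_all_iff.2 fun n => (hx n).1
  have hpt : ∀ᵐ ω ∂μ, ∃ y ∈ X ω, (∀ j, φ j y = (w ω)⁻¹ * u (ω, j)) ∧
      ∀ f : StrongDual ℝ Y, Tendsto (fun n => f (x (ns n) ω)) atTop (𝓝 (f y)) := by
    filter_upwards [hprod hae, hprod (ae_all_iff.2 fun n => hTF (x n) (hx n).1), hxX]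
      with ω h1 h2 h3
    refine (hwcomp ω).exists_weak_limit_of_separating hφ (fun n => h3 (ns n)) fun j => ?_
    refine ((h1 j).const_mul (w ω)⁻¹).congr fun n => ?_
    rw [h2 j (ns n)]
    exact inv_mul_cancel_left₀ (hw0 ω).ne' _
  have hpt' : ∀ ω, ∃ y : Y, (∃ y ∈ X ω, (∀ j, φ j y = (w ω)⁻¹ * u (ω, j)) ∧
      ∀ f : StrongDual ℝ Y, Tendsto (fun n => f (x (ns n) ω)) atTop (𝓝 (f y))) →
      y ∈ X ω ∧ (∀ j, φ j y = (w ω)⁻¹ * u (ω, j)) ∧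
      ∀ f : StrongDual ℝ Y, Tendsto (fun n => f (x (ns n) ω)) atTop (𝓝 (f y)) := by
    intro ω
    by_cases h : ∃ y ∈ X ω, (∀ j, φ j y = (w ω)⁻¹ * u (ω, j)) ∧
      ∀ f : StrongDual ℝ Y, Tendsto (fun n => f (x (ns n) ω)) atTop (𝓝 (f y))
    · exact h.imp fun y hy _ => hy
    · exact ⟨0, fun h' => absurd h' h⟩
  choose y hy using hpt'
  replace hpt := hpt.mono hy
  have hym : AEStronglyMeasurable y μ := by
    have he : MeasurableEmbedding fun (z : Y) j => φ j z :=
      (continuous_pi fun j => (φ j).continuous).measurableEmbedding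
        fun z z' h => hφ z z' (congrFun h)
    obtain ⟨r, hr, hre⟩ := he.exists_measurable_extend measurable_id fun _ => ⟨0⟩
    have hum : Measurable fun ω j => (w ω)⁻¹ * u (ω, j) := measurable_pi_lambda _ fun j =>
      hwm.inv.mul ((Lp.stronglyMeasurable u).measurable.comp measurable_prodMk_right)
    refine AEMeasurable.aestronglyMeasurable ⟨_, hr.comp hum, ?_⟩
    filter_upwards [hpt] with ω hω
    have : (fun j => (w ω)⁻¹ * u (ω, j)) = fun j => φ j (y ω) := funext fun j => (hω.2.1 j).symm
    rw [Function.comp_apply, this]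
    exact (congrFun hre (y ω)).symm
  have hyi : Integrable y μ := hk.mono' hym <| by
    filter_upwards [hpt, hXk] with ω h1 h2 using h2 _ h1.1
  let x₀ : Lp Y 1 μ := (memLp_one_iff_integrable.2 hyi).toLp
  have hx₀ : x₀ =ᵐ[μ] y := MemLp.coeFn_toLp _
  have hx₀S : x₀ ∈ S := by
    filter_upwards [hpt, hx₀] with ω h1 h2
    rw [h2]
    exact h1.1
  refine ⟨x₀, ⟨hx₀S, ?_⟩, ?_⟩
  · have hLlim : Tendsto (fun n => L (x (ns n))) atTop (𝓝 (L x₀)) := by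
      simp only [hL]
      refine tendsto_integral_of_dominated_convergence (fun ω => ‖L‖ * k ω)
        (fun n => hlm _ (Lp.aestronglyMeasurable _)) (hk.const_mul _) (fun n => ?_) ?_
      · filter_upwards [hxX, hXk] with ω h1 h2
        exact (hlb ω _).trans (mul_le_mul_of_nonneg_left (h2 _ (h1 _)) (norm_nonneg _))
      · filter_upwards [hpt, hx₀] with ω h1 h2
        rw [h2]
        exact h1.2.2 _
    exact le_of_tendsto' hLlim fun n => (hx (ns n)).2
  · refine Lp.ext ?_
    filter_upwards [hTF x₀ hx₀S, hfst hpt, hfst hx₀] with q h1 h2 h3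
    rw [h1]
    simp only [F, h3, h2.2.1]
    exact mul_inv_cancel_left₀ (hw0 _).ne' _

end Selections

/-- Diestel's theorem together with the Aumann selection theorem: the set of
integrable selections of an integrably bounded, nonempty, convex, weakly
compact valued correspondence with measurable graph is nonempty, convex and
weakly compact in `L¹(μ, Y)`. -/
theorem selections_nonempty_convex_weaklyCompact {Ω Y : Type*} [MeasurableSpace Ω]
    [NormedAddCommGroup Y] [NormedSpace ℝ Y] [CompleteSpace Y]
    [SecondCountableTopology Y] [MeasurableSpace Y] [BorelSpace Y]
    {μ : Measure Ω} [IsFiniteMeasure μ] (hμ : μ.IsComplete)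
    (X : Ω → Set Y)
    (hne : ∀ ω, (X ω).Nonempty) (hconv : ∀ ω, Convex ℝ (X ω))
    (hwcomp : ∀ ω, IsCompact (toWeakSpace ℝ Y '' (X ω)))
    (hgraph : MeasurableSet {p : Ω × Y | p.2 ∈ X p.1})
    (hbd : ∃ h : Ω → ℝ, Integrable h μ ∧ ∀ᵐ ω ∂μ, ∀ y ∈ X ω, ‖y‖ ≤ h ω) :
    (let S : Set (Lp Y 1 μ) := {x : Lp Y 1 μ | ∀ᵐ ω ∂μ, x ω ∈ X ω}
    S.Nonempty ∧ Convex ℝ S ∧ IsCompact (toWeakSpace ℝ (Lp Y 1 μ) '' S)) := by 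
  obtain ⟨h, hh, hhX⟩ := hbd
  obtain ⟨g, hg, hhg⟩ := hh.aestronglyMeasurable
  have hk : Integrable (fun ω => |g ω|) μ := (hh.congr hhg).abs
  have hXk : ∀ᵐ ω ∂μ, ∀ y ∈ X ω, ‖y‖ ≤ |g ω| := by
    filter_upwards [hhX, hhg] with ω h1 h2 y hy
    exact (h1 y hy).trans (h2 ▸ le_abs_self _)
  have hS : Convex ℝ {x : Lp Y 1 μ | ∀ᵐ ω ∂μ, x ω ∈ X ω} := by
    intro x hx y hy a b ha hb hab
    filter_upwards [hx, hy, Lp.coeFn_add (a • x) (b • y), Lp.coeFn_smul a x, Lp.coeFn_smul b y]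
      with ω h1 h2 h3 h4 h5
    rw [h3, Pi.add_apply, h4, h5]
    exact hconv ω h1 h2 ha hb hab
  refine ⟨?_, hS, isCompact_toWeakSpace_image_selections hwcomp hg.norm hk
    (fun ω => abs_nonneg _) hXk hS⟩
  obtain ⟨f, hf, hfX⟩ := exists_measurable_ae_selection μ hgraph hne
  have hfi : Integrable f μ := hk.mono' hf.aestronglyMeasurable <| by
    filter_upwards [hfX, hXk] with ω h1 h2 using h2 _ h1
  refine ⟨(memLp_one_iff_integrable.2 hfi).toLp, ?_⟩
  filter_upwards [hfX, (memLp_one_iff_integrable.2 hfi).coeFn_toLp] with ω h1 h2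
  rw [h2]
  exact h1
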